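/- Let V be a quadratic space over an algebraically closed field k of characteristic 0, of countably infinite dimension, with nondegenerate symmetric bilinear form (rank ∞, zero radical). Then V is homogeneous: any isometry between finite-dimensional subspaces of V extends to an isometry of V onto itself. -/

import Mathlib

section Helpers

variable {k V : Type*} [Field k] [AddCommGroup V] [Module k V]

/-- The orthogonal complement of a finite-dimensional subspace has an anisotropic vector. -/
lemma exists_aniso [CharZero k]
    (ω : V →ₗ[k] V →ₗ[k] k) (hsymm : ∀ x y, ω x y = ω y x)
    (hinf : ¬ FiniteDimensional k V)
    (hnondeg : LinearMap.ker ω = ⊥) (U : Submodule k V) [FiniteDimensional k U] :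
    ∃ x, (∀ u ∈ U, ω u x = 0) ∧ ω x x ≠ 0 := by
  by_contra! hcon
  apply hinf
  let φ : V →ₗ[k] Module.Dual k U := (ω.comp U.subtype).flip
  have hP : ∀ x, x ∈ LinearMap.ker φ ↔ ∀ u ∈ U, ω u x = 0 := by
    intro x
    rw [LinearMap.mem_ker]
    constructor
    · intro h u hu
      exact LinearMap.congr_fun h ⟨u, hu⟩
    · intro h
      ext u
      exact h u u.2
  have hiso : ∀ x ∈ LinearMap.ker φ, ∀ y ∈ LinearMap.ker φ, ω x y = 0 := by
    intro x hx y hy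
    have h1 := hcon x ((hP x).1 hx)
    have h2 := hcon y ((hP y).1 hy)
    have h3 := hcon (x + y) ((hP _).1 (add_mem hx hy))
    simp only [map_add, LinearMap.add_apply] at h3
    rw [h1, h2, hsymm y x] at h3
    have : (2 : k) * ω x y = 0 := by linear_combination h3
    simpa using this
  obtain ⟨C, hC⟩ := Submodule.exists_isCompl (LinearMap.ker φ)
  have hQ : FiniteDimensional k (V ⧸ LinearMap.ker φ) :=
    Module.Finite.equiv φ.quotKerEquivRange.symm
  have hCf : FiniteDimensional k C :=
    Module.Finite.equiv (Submodule.quotientEquivOfIsCompl _ _ hC)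
  let ψ : LinearMap.ker φ →ₗ[k] Module.Dual k C :=
    (C.subtype.dualMap.comp ω).comp (LinearMap.ker φ).subtype
  have hψ : Function.Injective ψ := by
    rw [← LinearMap.ker_eq_bot, LinearMap.ker_eq_bot']
    intro x hx
    have h0 : (x : V) ∈ LinearMap.ker ω := by
      rw [LinearMap.mem_ker]
      ext y
      have hy : y ∈ LinearMap.ker φ ⊔ C := by rw [hC.sup_eq_top]; trivial
      obtain ⟨p, hp, c, hc, rfl⟩ := Submodule.mem_sup.1 hy
      have h1 : ω x c = 0 := LinearMap.congr_fun hx ⟨c, hc⟩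
      rw [map_add, hiso x x.2 p hp, h1]
      simp
    rw [hnondeg] at h0
    exact Subtype.ext (by simpa using h0)
  have hPf : FiniteDimensional k (LinearMap.ker φ) := Module.Finite.of_injective ψ hψ
  exact Module.Finite.of_submodule_quotient (LinearMap.ker φ)

/-- Graphs of isometries between finite-dimensional subspaces. -/
def GoodGraph (ω : V →ₗ[k] V →ₗ[k] k) (G : Submodule k (V × V)) : Prop :=
  FiniteDimensional k G ∧ (∀ g ∈ G, ∀ h ∈ G, ω g.2 h.2 = ω g.1 h.1) ∧
    (∀ g ∈ G, g.2 = 0 → g.1 = 0) ∧ (∀ g ∈ G, g.1 = 0 → g.2 = 0)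

lemma GoodGraph.forth [IsAlgClosed k] [CharZero k]
    (ω : V →ₗ[k] V →ₗ[k] k) (hsymm : ∀ x y, ω x y = ω y x)
    (hinf : ¬ FiniteDimensional k V)
    (hnondeg : LinearMap.ker ω = ⊥) (G : Submodule k (V × V)) (hG : GoodGraph ω G) (v : V) :
    ∃ G', GoodGraph ω G' ∧ G ≤ G' ∧ ∃ w, (v, w) ∈ G' := by
  by_cases hv : ∃ w, (v, w) ∈ G
  · exact ⟨G, hG, le_rfl, hv⟩
  obtain ⟨hfd, hiso, hl, hr⟩ := hG
  let U : Submodule k V := G.map (LinearMap.snd k V V)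
  have hUmem : ∀ g ∈ G, g.2 ∈ U := fun g hg => ⟨g, hg, rfl⟩
  have hωi : ∀ x, ω x = 0 → x = 0 := LinearMap.ker_eq_bot'.1 hnondeg
  let B : G →ₗ[k] V →ₗ[k] k := ω.comp ((LinearMap.snd k V V).comp G.subtype)
  have hB : Function.Injective B := by
    rw [← LinearMap.ker_eq_bot, LinearMap.ker_eq_bot']
    intro g hg
    have h2 : (g : V × V).2 = 0 := hωi _ hg
    exact Subtype.ext (Prod.ext (hl g g.2 h2) h2)
  have hBs : Function.Surjective B.flip := LinearMap.flip_surjective_iff₁.2 hB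
  obtain ⟨u1, hu1⟩ := hBs ((ω v).comp ((LinearMap.fst k V V).comp G.subtype))
  have hu1' : ∀ g ∈ G, ω g.2 u1 = ω v g.1 := fun g hg => LinearMap.congr_fun hu1 ⟨g, hg⟩
  have hu0 : ∃ u0, u0 ∉ U ∧ ∀ g ∈ G, ω g.2 u0 = ω v g.1 := by
    by_cases h : u1 ∈ U
    · obtain ⟨x, hx, hxx⟩ := exists_aniso ω hsymm hinf hnondeg U
      refine ⟨u1 + x, fun hmem => hxx (hx x ?_), fun g hg => ?_⟩
      · simpa using sub_mem hmem h
      · rw [map_add, hu1' g hg, hx _ (hUmem g hg), add_zero]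
    · exact ⟨u1, h, hu1'⟩
  obtain ⟨u0, hu0U, hu0⟩ := hu0
  obtain ⟨x, hx, hxx⟩ := exists_aniso ω hsymm hinf hnondeg (U ⊔ Submodule.span k {u0})
  obtain ⟨t, ht⟩ := IsAlgClosed.exists_pow_nat_eq ((ω v v - ω u0 u0) / ω x x) (n := 2) (by norm_num)
  have hxU : ∀ u ∈ U, ω u x = 0 := fun u hu => hx u (Submodule.mem_sup_left hu)
  have hxu0 : ω u0 x = 0 :=
    hx u0 (Submodule.mem_sup_right (Submodule.mem_span_singleton_self u0))
  have hw1 : ∀ g ∈ G, ω g.2 (u0 + t • x) = ω g.1 v := by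
    intro g hg
    rw [map_add, map_smul, hu0 g hg, hxU _ (hUmem g hg), smul_zero, add_zero, hsymm]
  have hw2 : ω (u0 + t • x) (u0 + t • x) = ω v v := by
    simp only [map_add, map_smul, LinearMap.add_apply, LinearMap.smul_apply, smul_eq_mul,
      hsymm x u0, hxu0]
    field_simp at ht
    linear_combination ht
  have hwU : u0 + t • x ∉ U := by
    intro hmem
    have h1 := hxU _ hmem
    simp only [map_add, map_smul, LinearMap.add_apply, LinearMap.smul_apply, smul_eq_mul,
      hxu0, zero_add] at h1
    have ht0 : t = 0 := (mul_eq_zero.1 h1).resolve_right hxx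
    rw [ht0] at hmem
    exact hu0U (by simpa using hmem)
  generalize u0 + t • x = w at hw1 hw2 hwU
  have hmem : ∀ g, g ∈ G ⊔ Submodule.span k {(v, w)} ↔ ∃ h ∈ G, ∃ s : k, g = h + s • (v, w) := by
    intro g
    rw [Submodule.mem_sup]
    constructor
    · rintro ⟨h, hh, z, hz, rfl⟩
      obtain ⟨s, rfl⟩ := Submodule.mem_span_singleton.1 hz
      exact ⟨h, hh, s, rfl⟩
    · rintro ⟨h, hh, s, rfl⟩
      exact ⟨h, hh, _, Submodule.smul_mem _ _ (Submodule.mem_span_singleton_self _), rfl⟩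
  refine ⟨G ⊔ Submodule.span k {(v, w)}, ⟨inferInstance, ?_, ?_, ?_⟩, le_sup_left, w,
    Submodule.mem_sup_right (Submodule.mem_span_singleton_self _)⟩
  · intro g hg' h hh'
    obtain ⟨g, hg, s, rfl⟩ := (hmem _).1 hg'
    obtain ⟨h, hh, r, rfl⟩ := (hmem _).1 hh'
    simp only [Prod.snd_add, Prod.fst_add, Prod.smul_fst, Prod.smul_snd, map_add, map_smul,
      LinearMap.add_apply, LinearMap.smul_apply, smul_eq_mul]
    rw [hiso g hg h hh, hw1 g hg, hw2, hsymm w, hw1 h hh, hsymm v h.1]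
  · intro g hg' h0
    obtain ⟨g, hg, s, rfl⟩ := (hmem _).1 hg'
    have hs : s = 0 := by
      by_contra hs
      apply hwU
      have h1 : s • w ∈ U := by
        have : s • w = -g.2 := by
          rw [eq_neg_iff_add_eq_zero, add_comm]; simpa using h0
        rw [this]
        exact neg_mem (hUmem g hg)
      exact (Submodule.smul_mem_iff _ hs).1 h1
    subst hs
    simp only [zero_smul, add_zero] at h0 ⊢
    exact hl g hg h0
  · intro g hg' h0
    obtain ⟨g, hg, s, rfl⟩ := (hmem _).1 hg'
    have hs : s = 0 := by
      by_contra hs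
      apply hv
      have h1 : s • v = -g.1 := by
        rw [eq_neg_iff_add_eq_zero, add_comm]; simpa using h0
      refine ⟨s⁻¹ • (-g.2), ?_⟩
      have h2 : v = s⁻¹ • (-g.1) := by rw [← h1, inv_smul_smul₀ hs]
      have h3 : (v, s⁻¹ • (-g.2)) = s⁻¹ • (-g) := by
        ext
        · exact h2
        · rfl
      rw [h3]
      exact G.smul_mem _ (neg_mem hg)
    subst hs
    simp only [zero_smul, add_zero] at h0 ⊢
    exact hr g hg h0

/-- Swapping the two coordinates of a good graph. -/
lemma GoodGraph.swap (ω : V →ₗ[k] V →ₗ[k] k) (G : Submodule k (V × V)) (hG : GoodGraph ω G) :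
    GoodGraph ω (G.map (LinearEquiv.prodComm k V V).toLinearMap) := by
  obtain ⟨hfd, hiso, hl, hr⟩ := hG
  refine ⟨inferInstance, ?_, ?_, ?_⟩
  · rintro _ ⟨g, hg, rfl⟩ _ ⟨h, hh, rfl⟩
    exact (hiso g hg h hh).symm
  · rintro _ ⟨g, hg, rfl⟩ h
    exact hr g hg h
  · rintro _ ⟨g, hg, rfl⟩ h
    exact hl g hg h

lemma GoodGraph.step [IsAlgClosed k] [CharZero k]
    (ω : V →ₗ[k] V →ₗ[k] k) (hsymm : ∀ x y, ω x y = ω y x)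
    (hinf : ¬ FiniteDimensional k V)
    (hnondeg : LinearMap.ker ω = ⊥) (G : Submodule k (V × V)) (hG : GoodGraph ω G) (v : V) :
    ∃ G', GoodGraph ω G' ∧ G ≤ G' ∧ (∃ w, (v, w) ∈ G') ∧ ∃ w, (w, v) ∈ G' := by
  obtain ⟨G1, h1, hle1, w, hw⟩ := hG.forth ω hsymm hinf hnondeg G v
  obtain ⟨G2, h2, hle2, w', hw'⟩ := (h1.swap ω G1).forth ω hsymm hinf hnondeg _ v
  have hle : G1 ≤ G2.map (LinearEquiv.prodComm k V V).toLinearMap := fun g hg =>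
    ⟨g.swap, hle2 ⟨g, hg, rfl⟩, rfl⟩
  exact ⟨_, h2.swap ω G2, hle1.trans hle, ⟨w, hle hw⟩, w', ⟨_, hw', rfl⟩⟩

end Helpers

/-- A countable-dimensional quadratic space over an algebraically closed field of
characteristic 0 with nondegenerate symmetric bilinear form is homogeneous: every isometry
from a finite-dimensional subspace into `V` extends to an isometry of `V` onto itself. -/
theorem stmt9 {k V : Type*} [Field k] [IsAlgClosed k] [CharZero k]
    [AddCommGroup V] [Module k V]
    (ω : V →ₗ[k] V →ₗ[k] k) (hsymm : ∀ x y, ω x y = ω y x)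
    (hdim : Module.rank k V = Cardinal.aleph0)
    (hnondeg : LinearMap.ker ω = ⊥) :
    ∀ (W : Submodule k V), FiniteDimensional k W →
      ∀ (α : W →ₗ[k] V), Function.Injective α →
        (∀ x y : W, ω (α x) (α y) = ω (x : V) (y : V)) →
        ∃ σ : V ≃ₗ[k] V, (∀ x y, ω (σ x) (σ y) = ω x y) ∧ ∀ x : W, σ (x : V) = α x := by
  intro W hW α hα hiso
  have hinf : ¬ FiniteDimensional k V := by
    intro h
    have := Module.rank_lt_aleph0 k V
    rw [hdim] at this
    exact lt_irrefl _ this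
  have hωi : ∀ x, ω x = 0 → x = 0 := LinearMap.ker_eq_bot'.1 hnondeg
  -- a countable basis
  let b0 := Module.Free.chooseBasis k V
  have hcard : Cardinal.mk (Module.Free.ChooseBasisIndex k V) = Cardinal.aleph0 := by
    rw [← hdim, Module.Free.rank_eq_card_chooseBasisIndex]
  obtain ⟨hden⟩ := Cardinal.denumerable_iff.2 hcard
  let b : Module.Basis ℕ k V := b0.reindex (Denumerable.eqv _)
  -- the initial graph
  let G0 : Submodule k (V × V) := LinearMap.range (W.subtype.prod α)
  have hG0 : GoodGraph ω G0 := by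
    refine ⟨inferInstance, ?_, ?_, ?_⟩
    · rintro _ ⟨x, rfl⟩ _ ⟨y, rfl⟩
      exact hiso x y
    · rintro _ ⟨x, rfl⟩ h
      have h' : α x = 0 := h
      have : x = 0 := hα (by rw [h', map_zero])
      subst this
      rfl
    · rintro _ ⟨x, rfl⟩ h
      have : x = 0 := Subtype.ext h
      subst this
      exact map_zero α
  choose F hF1 hF2 hF3 hF4 using fun (G : {G // GoodGraph ω G}) (v : V) =>
    GoodGraph.step ω hsymm hinf hnondeg G.1 G.2 v
  let S : ℕ → {G // GoodGraph ω G} := fun n =>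
    Nat.rec ⟨G0, hG0⟩ (fun n G => ⟨F G (b n), hF1 G (b n)⟩) n
  have hmono : Monotone (fun n => (S n).1) :=
    monotone_nat_of_le_succ fun n => hF2 (S n) (b n)
  let G : Submodule k (V × V) := ⨆ n, (S n).1
  have hmem : ∀ g, g ∈ G ↔ ∃ n, g ∈ (S n).1 := fun g =>
    Submodule.mem_iSup_of_directed _ hmono.directed_le
  have hGiso : ∀ g ∈ G, ∀ h ∈ G, ω g.2 h.2 = ω g.1 h.1 := by
    intro g hg h hh
    obtain ⟨n, hn⟩ := (hmem g).1 hg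
    obtain ⟨m, hm⟩ := (hmem h).1 hh
    exact (S (max n m)).2.2.1 g (hmono (le_max_left n m) hn) h (hmono (le_max_right n m) hm)
  have hGl : ∀ g ∈ G, g.2 = 0 → g.1 = 0 := fun g hg => by
    obtain ⟨n, hn⟩ := (hmem g).1 hg
    exact (S n).2.2.2.1 g hn
  have hGr : ∀ g ∈ G, g.1 = 0 → g.2 = 0 := fun g hg => by
    obtain ⟨n, hn⟩ := (hmem g).1 hg
    exact (S n).2.2.2.2 g hn
  let p1 : G →ₗ[k] V := (LinearMap.fst k V V).comp G.subtype
  let p2 : G →ₗ[k] V := (LinearMap.snd k V V).comp G.subtype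
  have hp1 : Function.Bijective p1 := by
    constructor
    · rw [← LinearMap.ker_eq_bot, LinearMap.ker_eq_bot']
      intro g hg
      exact Subtype.ext (Prod.ext hg (hGr g g.2 hg))
    · rw [← LinearMap.range_eq_top, eq_top_iff, ← b.span_eq, Submodule.span_le]
      rintro _ ⟨n, rfl⟩
      obtain ⟨w, hw⟩ := hF3 (S n) (b n)
      exact ⟨⟨(b n, w), (hmem _).2 ⟨n + 1, hw⟩⟩, rfl⟩
  have hp2 : Function.Bijective p2 := by
    constructor
    · rw [← LinearMap.ker_eq_bot, LinearMap.ker_eq_bot']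
      intro g hg
      exact Subtype.ext (Prod.ext (hGl g g.2 hg) hg)
    · rw [← LinearMap.range_eq_top, eq_top_iff, ← b.span_eq, Submodule.span_le]
      rintro _ ⟨n, rfl⟩
      obtain ⟨w, hw⟩ := hF4 (S n) (b n)
      exact ⟨⟨(w, b n), (hmem _).2 ⟨n + 1, hw⟩⟩, rfl⟩
  let e1 := LinearEquiv.ofBijective p1 hp1
  let e2 := LinearEquiv.ofBijective p2 hp2
  have hσ : ∀ g : G, (e1.symm.trans e2) (g : V × V).1 = (g : V × V).2 := by
    intro g
    have h1 : e1 g = (g : V × V).1 := rfl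
    rw [← h1, LinearEquiv.trans_apply, LinearEquiv.symm_apply_apply]
    rfl
  refine ⟨e1.symm.trans e2, ?_, ?_⟩
  · intro x y
    obtain ⟨g, rfl⟩ := hp1.2 x
    obtain ⟨h, rfl⟩ := hp1.2 y
    have hg := hσ g
    have hh := hσ h
    change ω ((e1.symm.trans e2) (g : V × V).1) ((e1.symm.trans e2) (h : V × V).1) = _
    rw [hg, hh]
    exact hGiso g g.2 h h.2
  · intro x
    exact hσ ⟨((x : V), α x), (hmem _).2 ⟨0, ⟨x, rfl⟩⟩⟩
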